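/- Let φ be a q-CSP-6 instance with n variables and m constraints, and let G(φ) be the associated constructed graph with budget k = Fm(2n+A) + 2n, where A = 4q+2 and F = (2n+1)(4n+1). If G(φ) has a minimal dominating set of size at least k, then φ is satisfiable. -/

import Mathlib

/-- `D` is a dominating set of `G`: every vertex belongs to `D` or has a neighbor in `D`. -/
def Dominates {V : Type*} (G : SimpleGraph V) (D : Set V) : Prop :=
  ∀ v : V, v ∈ D ∨ ∃ u ∈ D, G.Adj u v

/-- `D` is a minimal dominating set of `G`: dominating, and no proper subset dominates. -/
def MinimalDominatingSet {V : Type*} (G : SimpleGraph V) (D : Set V) : Prop :=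
  Dominates G D ∧ ∀ D' : Set V, D' ⊂ D → ¬ Dominates G D'

/-- A `q`-CSP-6 instance with `n` variables and `m` constraints: each constraint `j`
involves the `q` pairwise distinct variables `vars j 0, …, vars j (q-1)` and comes with
a nonempty list of `C j` satisfying assignments `sat j l : Fin q → Fin 6`. -/
structure QCSP (q n m : ℕ) where
  vars : Fin m → Fin q → Fin n
  vars_inj : ∀ j : Fin m, Function.Injective (vars j)
  C : Fin m → ℕ
  C_pos : ∀ j : Fin m, 0 < C j
  sat : (j : Fin m) → Fin (C j) → Fin q → Fin 6

/-- `φ` is satisfiable: some total assignment restricts, on each constraint,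
to one of the constraint's satisfying assignments. -/
def QCSP.Satisfiable {q n m : ℕ} (φ : QCSP q n m) : Prop :=
  ∃ ρ : Fin n → Fin 6, ∀ j : Fin m, ∃ l : Fin (φ.C j),
    ∀ p : Fin q, ρ (φ.vars j p) = φ.sat j l p

/-- `A = 4q + 2`. -/
def Anum (q : ℕ) : ℕ := 4 * q + 2

/-- `F = (2n+1)(4n+1)`. -/
def Fnum (n : ℕ) : ℕ := (2 * n + 1) * (4 * n + 1)

/-- For a section `j ∈ {0, …, Fm − 1}`, the index `j' = j mod m` of the associated
constraint. -/
def cIdx {n m : ℕ} (j : Fin (Fnum n * m)) : Fin m :=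
  ⟨j.val % m, Nat.mod_lt _ (by
    rcases Nat.eq_zero_or_pos m with h | h
    · exact absurd j.isLt (by simp [h])
    · exact h)⟩

/-- Vertices of the constructed graph `G(φ)`:
* `path i t` is the path vertex `u_{i, t−3}` (so `t : Fin (4Fm+6)` ranges over the paper
  indices `−3, …, 4Fm+2`);
* `kvert j l a` is the `a`-th vertex of the clique part `K_j^l`;
* `lvert j l a` is the `a`-th vertex of the clique part `L_j^l`;
* `wvert j` is the vertex `w_j`. -/
inductive CVert (q n m : ℕ) (C : Fin m → ℕ) : Type where
  | path (i : Fin n) (t : Fin (4 * (Fnum n * m) + 6))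
  | kvert (j : Fin (Fnum n * m)) (l : Fin (C (cIdx j))) (a : Fin (Anum q))
  | lvert (j : Fin (Fnum n * m)) (l : Fin (C (cIdx j))) (a : Fin (Anum q))
  | wvert (j : Fin (Fnum n * m))

/-- First path-offset associated to a value `v ∈ {0,…,5}`:
`2, 3, 0, 1, 1, 0` respectively. -/
def off1 (v : Fin 6) : ℕ :=
  match v.val with
  | 0 => 2 | 1 => 3 | 2 => 0 | 3 => 1 | 4 => 1 | _ => 0

/-- Second path-offset associated to a value `v ∈ {0,…,5}`:
`3, 0, 1, 2, 3, 2` respectively. -/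
def off2 (v : Fin 6) : ℕ :=
  match v.val with
  | 0 => 3 | 1 => 0 | 2 => 1 | 3 => 2 | 4 => 3 | _ => 2

/-- The base edge relation of `G(φ)` (before symmetrization):
consecutive path vertices; `K_j` a clique; `L_j` a clique; each vertex of `K_j^l`
joined to the two path vertices of `Q_{i,j}` determined by `σ_l(x_i)` for every
variable `x_i` involved in the constraint `c_{j mod m}`; a perfect matching between
`K_j^l` and `L_j^l` and all edges between `K_j^l` and `L_j^{l'}` for `l ≠ l'`;
`w_j` joined to all of `L_j`. -/
def cspRel (q n m : ℕ) (φ : QCSP q n m) :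
    CVert q n m φ.C → CVert q n m φ.C → Prop
  | .path i t, .path i' t' => i = i' ∧ t'.val = t.val + 1
  | .kvert j _ _, .kvert j' _ _ => j = j'
  | .lvert j _ _, .lvert j' _ _ => j = j'
  | .kvert j l _, .path i t =>
      ∃ p : Fin q, φ.vars (cIdx j) p = i ∧
        (t.val = 4 * j.val + off1 (φ.sat (cIdx j) l p) + 3 ∨
         t.val = 4 * j.val + off2 (φ.sat (cIdx j) l p) + 3)
  | .kvert j l a, .lvert j' l' a' => j = j' ∧ (l.val = l'.val → a = a')
  | .wvert j, .lvert j' _ _ => j = j'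
  | _, _ => False

/-- The constructed graph `G(φ)`. -/
def cspGraph (q n m : ℕ) (φ : QCSP q n m) : SimpleGraph (CVert q n m φ.C) :=
  SimpleGraph.fromRel (cspRel q n m φ)

/-- The budget `k = Fm(2n + A) + 2n`. -/
def budget (q n m : ℕ) : ℕ := Fnum n * m * (2 * n + Anum q) + 2 * n

/-- `v` is a private neighbor of `u` with respect to `D`: it lies in the closed neighborhood
of `u` and of no other vertex of `D`. -/
def IsPrivateNeighbor {V : Type*} (G : SimpleGraph V) (D : Set V) (u v : V) : Prop :=
  (v = u ∨ G.Adj u v) ∧ ∀ x ∈ D, x = v ∨ G.Adj x v → x = u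

theorem MinimalDominatingSet.exists_isPrivateNeighbor {V : Type*} {G : SimpleGraph V}
    {D : Set V} (hD : MinimalDominatingSet G D) {u : V} (hu : u ∈ D) :
    ∃ v, IsPrivateNeighbor G D u v := by
  have h := hD.2 (D \ {u}) (Set.sdiff_singleton_ssubset.2 hu)
  simp only [Dominates, not_forall, not_or, not_exists, not_and] at h
  obtain ⟨v, hv, hadj⟩ := h
  have key : ∀ x ∈ D, x = v ∨ G.Adj x v → x = u := by
    intro x hx hxv
    by_contra hne
    rcases hxv with rfl | hxv
    · exact hv ⟨hx, hne⟩
    · exact hadj x ⟨hx, hne⟩ hxv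
  refine ⟨v, ?_, key⟩
  rcases hD.1 v with h | ⟨x, hx, hxv⟩
  · exact Or.inl (key v h (Or.inl rfl))
  · exact Or.inr (key x hx (Or.inr hxv) ▸ hxv)

section Adjacency

variable {q n m : ℕ} {φ : QCSP q n m}

@[simp] theorem adj_path_path {i i' : Fin n} {t t' : Fin (4 * (Fnum n * m) + 6)} :
    (cspGraph q n m φ).Adj (.path i t) (.path i' t') ↔
      i = i' ∧ (t'.val = t.val + 1 ∨ t.val = t'.val + 1) := by
  simp only [cspGraph, SimpleGraph.fromRel_adj, cspRel, ne_eq, CVert.path.injEq]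
  constructor
  · rintro ⟨-, ⟨h, h'⟩ | ⟨h, h'⟩⟩
    · exact ⟨h, Or.inl h'⟩
    · exact ⟨h.symm, Or.inr h'⟩
  · rintro ⟨h, h'⟩
    refine ⟨fun h'' => ?_, ?_⟩
    · have := congrArg Fin.val h''.2
      omega
    · exact h'.imp (fun h' => ⟨h, h'⟩) (fun h' => ⟨h.symm, h'⟩)

@[simp] theorem adj_kvert_path {j : Fin (Fnum n * m)} {l : Fin (φ.C (cIdx j))}
    {a : Fin (Anum q)} {i : Fin n} {t : Fin (4 * (Fnum n * m) + 6)} :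
    (cspGraph q n m φ).Adj (.kvert j l a) (.path i t) ↔
      ∃ p : Fin q, φ.vars (cIdx j) p = i ∧
        (t.val = 4 * j.val + off1 (φ.sat (cIdx j) l p) + 3 ∨
         t.val = 4 * j.val + off2 (φ.sat (cIdx j) l p) + 3) := by
  simp [cspGraph, cspRel]

@[simp] theorem adj_path_kvert {j : Fin (Fnum n * m)} {l : Fin (φ.C (cIdx j))}
    {a : Fin (Anum q)} {i : Fin n} {t : Fin (4 * (Fnum n * m) + 6)} :
    (cspGraph q n m φ).Adj (.path i t) (.kvert j l a) ↔
      ∃ p : Fin q, φ.vars (cIdx j) p = i ∧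
        (t.val = 4 * j.val + off1 (φ.sat (cIdx j) l p) + 3 ∨
         t.val = 4 * j.val + off2 (φ.sat (cIdx j) l p) + 3) := by
  rw [SimpleGraph.adj_comm, adj_kvert_path]

theorem adj_kvert_kvert {j j' : Fin (Fnum n * m)} {l : Fin (φ.C (cIdx j))}
    {l' : Fin (φ.C (cIdx j'))} {a a' : Fin (Anum q)} :
    (cspGraph q n m φ).Adj (.kvert j l a) (.kvert j' l' a') ↔
      (CVert.kvert j l a : CVert q n m φ.C) ≠ .kvert j' l' a' ∧ j = j' := by
  simp [cspGraph, cspRel, eq_comm]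

theorem adj_lvert_lvert {j j' : Fin (Fnum n * m)} {l : Fin (φ.C (cIdx j))}
    {l' : Fin (φ.C (cIdx j'))} {a a' : Fin (Anum q)} :
    (cspGraph q n m φ).Adj (.lvert j l a) (.lvert j' l' a') ↔
      (CVert.lvert j l a : CVert q n m φ.C) ≠ .lvert j' l' a' ∧ j = j' := by
  simp [cspGraph, cspRel, eq_comm]

@[simp] theorem adj_kvert_lvert {j j' : Fin (Fnum n * m)} {l : Fin (φ.C (cIdx j))}
    {l' : Fin (φ.C (cIdx j'))} {a a' : Fin (Anum q)} :
    (cspGraph q n m φ).Adj (.kvert j l a) (.lvert j' l' a') ↔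
      j = j' ∧ (l.val = l'.val → a = a') := by
  simp [cspGraph, cspRel]

@[simp] theorem adj_lvert_kvert {j j' : Fin (Fnum n * m)} {l : Fin (φ.C (cIdx j))}
    {l' : Fin (φ.C (cIdx j'))} {a a' : Fin (Anum q)} :
    (cspGraph q n m φ).Adj (.lvert j l a) (.kvert j' l' a') ↔
      j' = j ∧ (l'.val = l.val → a' = a) := by
  rw [SimpleGraph.adj_comm, adj_kvert_lvert]

@[simp] theorem adj_wvert_lvert {j j' : Fin (Fnum n * m)} {l' : Fin (φ.C (cIdx j'))}
    {a' : Fin (Anum q)} :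
    (cspGraph q n m φ).Adj (.wvert j) (.lvert j' l' a') ↔ j = j' := by
  simp [cspGraph, cspRel]

@[simp] theorem adj_lvert_wvert {j j' : Fin (Fnum n * m)} {l' : Fin (φ.C (cIdx j'))}
    {a' : Fin (Anum q)} :
    (cspGraph q n m φ).Adj (.lvert j' l' a') (.wvert j) ↔ j = j' := by
  rw [SimpleGraph.adj_comm, adj_wvert_lvert]

@[simp] theorem not_adj_path_lvert {i : Fin n} {t : Fin (4 * (Fnum n * m) + 6)}
    {j : Fin (Fnum n * m)} {l : Fin (φ.C (cIdx j))} {a : Fin (Anum q)} :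
    ¬ (cspGraph q n m φ).Adj (.path i t) (.lvert j l a) := by
  simp [cspGraph, cspRel]

@[simp] theorem not_adj_lvert_path {i : Fin n} {t : Fin (4 * (Fnum n * m) + 6)}
    {j : Fin (Fnum n * m)} {l : Fin (φ.C (cIdx j))} {a : Fin (Anum q)} :
    ¬ (cspGraph q n m φ).Adj (.lvert j l a) (.path i t) := by
  simp [cspGraph, cspRel]

@[simp] theorem not_adj_path_wvert {i : Fin n} {t : Fin (4 * (Fnum n * m) + 6)}
    {j : Fin (Fnum n * m)} : ¬ (cspGraph q n m φ).Adj (.path i t) (.wvert j) := by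
  simp [cspGraph, cspRel]

@[simp] theorem not_adj_wvert_path {i : Fin n} {t : Fin (4 * (Fnum n * m) + 6)}
    {j : Fin (Fnum n * m)} : ¬ (cspGraph q n m φ).Adj (.wvert j) (.path i t) := by
  simp [cspGraph, cspRel]

@[simp] theorem not_adj_kvert_wvert {j j' : Fin (Fnum n * m)} {l : Fin (φ.C (cIdx j))}
    {a : Fin (Anum q)} : ¬ (cspGraph q n m φ).Adj (.kvert j l a) (.wvert j') := by
  simp [cspGraph, cspRel]

@[simp] theorem not_adj_wvert_kvert {j j' : Fin (Fnum n * m)} {l : Fin (φ.C (cIdx j))}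
    {a : Fin (Anum q)} : ¬ (cspGraph q n m φ).Adj (.wvert j') (.kvert j l a) := by
  simp [cspGraph, cspRel]

@[simp] theorem not_adj_wvert_wvert {j j' : Fin (Fnum n * m)} :
    ¬ (cspGraph q n m φ).Adj (.wvert j) (.wvert j') := by
  simp [cspGraph, cspRel]

end Adjacency

theorem off1_lt (v : Fin 6) : off1 v < 4 := by
  revert v; decide

theorem off2_lt (v : Fin 6) : off2 v < 4 := by
  revert v; decide

instance CVert.instFinite (q n m : ℕ) (C : Fin m → ℕ) : Finite (CVert q n m C) := by
  refine Finite.of_injective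
    (β := (Fin n × Fin (4 * (Fnum n * m) + 6)) ⊕
      (Σ j : Fin (Fnum n * m), Fin (C (cIdx j)) × Fin (Anum q)) ⊕
      (Σ j : Fin (Fnum n * m), Fin (C (cIdx j)) × Fin (Anum q)) ⊕ Fin (Fnum n * m))
    (fun v => match v with
      | .path i t => .inl (i, t)
      | .kvert j l a => .inr (.inl ⟨j, l, a⟩)
      | .lvert j l a => .inr (.inr (.inl ⟨j, l, a⟩))
      | .wvert j => .inr (.inr (.inr j))) ?_
  rintro (_ | _ | _ | _) (_ | _ | _ | _) h <;> simp_all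
  all_goals grind

theorem IsPrivateNeighbor.eq {V : Type*} {G : SimpleGraph V} {D : Set V} {u u' v : V}
    (h : IsPrivateNeighbor G D u v) (h' : IsPrivateNeighbor G D u' v) (hu' : u' ∈ D) :
    u' = u :=
  h.2 u' hu' (h'.1.imp Eq.symm id)

/-- The number of `true` among four bits. -/
def bitCount (x : Fin 4 → Bool) : ℕ := ∑ k, (x k).toNat

/-- The order in which the two-element patterns of a section can follow one another along a
path: `1100, 1010, {1001, 0110}, 0101, 0011`. -/
def patternRank (x : Fin 4 → Bool) : ℕ :=
  match x 0, x 1, x 2, x 3 with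
  | true, true, _, _ => 0
  | true, _, true, _ => 1
  | _, true, _, true => 3
  | _, _, true, true => 4
  | _, _, _, _ => 2

/-- The value whose two path offsets are exactly the zeros of the pattern. -/
def patternValue (x : Fin 4 → Bool) : Fin 6 :=
  match x 0, x 1, x 2, x 3 with
  | true, true, _, _ => 0
  | true, _, true, _ => 4
  | true, _, _, _ => 3
  | _, true, true, _ => 1
  | _, true, _, _ => 5
  | _, _, _, _ => 2

theorem patternRank_le (x : Fin 4 → Bool) : patternRank x ≤ 4 := by
  revert x; decide

theorem patternValue_eq : ∀ (x : Fin 4 → Bool) (v : Fin 6), bitCount x = 2 →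
    x ⟨off1 v, off1_lt v⟩ = false → x ⟨off2 v, off2_lt v⟩ = false → patternValue x = v := by
  decide

/-- Two consecutive patterns satisfying the domination and private neighbor conditions have
nondecreasing ranks, and equal ranks only when they coincide. -/
theorem patternRank_mono_aux : ∀ a b c d e f g h : Bool,
    a.toNat + b.toNat + c.toNat + d.toNat = 2 → e.toNat + f.toNat + g.toNat + h.toNat = 2 →
    (b || c || d) → (c || d || e) → (d || e || f) → (e || f || g) →
    (c → (!b && !d) || (!d && !e) || (!b && !a)) →
    (d → (!c && !e) || (!e && !f) || (!c && !b)) →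
    (e → (!d && !f) || (!f && !g) || (!d && !c)) →
    (f → (!e && !g) || (!g && !h) || (!e && !d)) →
    patternRank ![a, b, c, d] ≤ patternRank ![e, f, g, h] ∧
      (patternRank ![a, b, c, d] = patternRank ![e, f, g, h] →
        a = e ∧ b = f ∧ c = g ∧ d = h) := by
  decide

section Rows

variable {q n m : ℕ} {φ : QCSP q n m} {D : Set (CVert q n m φ.C)}

/-- The vertex with index `t` of the path of variable `i` belongs to `D`. -/
def RowMem (D : Set (CVert q n m φ.C)) (i : Fin n) (t : ℕ) : Prop :=
  ∃ h : t < 4 * (Fnum n * m) + 6, CVert.path i ⟨t, h⟩ ∈ D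

/-- In a path in which the chosen positions are given by `b`, position `t` has a private
neighbor on the path. -/
def HasRowPrivate (b : ℕ → Prop) (t : ℕ) : Prop :=
  (¬ b (t + 1) ∧ ∀ s, s + 1 = t → ¬ b s) ∨ (¬ b (t + 1) ∧ ¬ b (t + 2)) ∨
    ∃ s, s + 1 = t ∧ ¬ b s ∧ ∀ r, r + 1 = s → ¬ b r

theorem HasRowPrivate.not_three {b : ℕ → Prop} {t : ℕ} (h : HasRowPrivate b (t + 1))
    (h0 : b t) (h2 : b (t + 2)) : False := by
  rcases h with h | h | ⟨s, hs, h, -⟩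
  · exact h.1 h2
  · exact h.1 h2
  · obtain rfl : s = t := by omega
    exact h h0

theorem HasRowPrivate.not_pair_left {b : ℕ → Prop} {t : ℕ} (h : HasRowPrivate b (t + 2))
    (h0 : b t) (h3 : b (t + 3)) : False := by
  rcases h with h | h | ⟨s, hs, -, h⟩
  · exact h.1 h3
  · exact h.1 h3
  · exact h t (by omega) h0

theorem HasRowPrivate.not_pair_right {b : ℕ → Prop} {t : ℕ} (h : HasRowPrivate b (t + 1))
    (h0 : b t) (h3 : b (t + 3)) : False := by
  rcases h with h | h | ⟨s, hs, h, -⟩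
  · exact h.2 t rfl h0
  · exact h.2 h3
  · obtain rfl : s = t := by omega
    exact h h0

theorem hasRowPrivate_or_kvert (hD : MinimalDominatingSet (cspGraph q n m φ) D) {i : Fin n}
    {t : Fin (4 * (Fnum n * m) + 6)} (ht : CVert.path i t ∈ D) :
    HasRowPrivate (RowMem D i) t ∨
      ∃ j l a, IsPrivateNeighbor (cspGraph q n m φ) D (.path i t) (.kvert j l a) := by
  obtain ⟨v, hv⟩ := hD.exists_isPrivateNeighbor ht
  rcases v with ⟨i', t'⟩ | ⟨j, l, a⟩ | ⟨j, l, a⟩ | j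
  · left
    have hnear : i' = i ∧ (t'.val = t.val ∨ t'.val = t.val + 1 ∨ t.val = t'.val + 1) := by
      rcases hv.1 with h | h
      · simp only [CVert.path.injEq] at h
        exact ⟨h.1, Or.inl (congrArg Fin.val h.2)⟩
      · rw [adj_path_path] at h
        exact ⟨h.1.symm, Or.inr h.2⟩
    obtain ⟨rfl, hnear⟩ := hnear
    have key : ∀ s, RowMem D i' s → (s = t' ∨ s = t'.val + 1 ∨ t'.val = s + 1) → s = t := by
      rintro s ⟨hs, hsD⟩ hst
      have := hv.2 _ hsD (by
        rcases hst with h | h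
        · left
          simp [h]
        · right
          rw [adj_path_path]
          exact ⟨rfl, h.symm⟩)
      simp only [CVert.path.injEq, true_and] at this
      exact congrArg Fin.val this
    rcases hnear with h | h | h
    · refine Or.inl ⟨fun hb => ?_, fun s hs hb => ?_⟩
      · have := key _ hb (by omega)
        omega
      · have := key _ hb (by omega)
        omega
    · refine Or.inr (Or.inl ⟨fun hb => ?_, fun hb => ?_⟩)
      · have := key _ hb (by omega)
        omega
      · have := key _ hb (by omega)
        omega
    · refine Or.inr (Or.inr ⟨t', h.symm, fun hb => ?_, fun s hs hb => ?_⟩)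
      · have := key _ hb (by omega)
        omega
      · have := key _ hb (by omega)
        omega
  · exact Or.inr ⟨j, l, a, hv⟩
  · simpa using hv.1
  · simpa using hv.1

theorem IsPrivateNeighbor.path_kvert_bounds {i : Fin n} {t : Fin (4 * (Fnum n * m) + 6)}
    {j : Fin (Fnum n * m)} {l : Fin (φ.C (cIdx j))} {a : Fin (Anum q)}
    (h : IsPrivateNeighbor (cspGraph q n m φ) D (.path i t) (.kvert j l a)) :
    (∃ p, φ.vars (cIdx j) p = i) ∧ 4 * j.val + 3 ≤ t ∧ t.val < 4 * j.val + 7 := by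
  have h := h.1
  simp only [reduceCtorEq, false_or, adj_path_kvert] at h
  obtain ⟨p, hp, h⟩ := h
  have h1 := off1_lt (φ.sat (cIdx j) l p)
  have h2 := off2_lt (φ.sat (cIdx j) l p)
  exact ⟨⟨p, hp⟩, by omega, by omega⟩

open Classical in
/-- The four bits recording which vertices of section `j` of the path of `i` are in `D`. -/
noncomputable def pattern (D : Set (CVert q n m φ.C)) (i : Fin n) (j : ℕ) : Fin 4 → Bool :=
  fun k => decide (RowMem D i (4 * j + 3 + k))

theorem bitCount_le_four (x : Fin 4 → Bool) : bitCount x ≤ 4 := by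
  revert x; decide

theorem bitCount_pattern_le_two {i : Fin n} {j : ℕ}
    (h : ∀ k : Fin 4, RowMem D i (4 * j + 3 + k) →
      HasRowPrivate (RowMem D i) (4 * j + 3 + k)) :
    bitCount (pattern D i j) ≤ 2 := by
  have hbits : ∀ x : Fin 4 → Bool, ¬ (x 0 ∧ x 1 ∧ x 2) → ¬ (x 1 ∧ x 2 ∧ x 3) →
      ¬ (x 0 ∧ x 2 ∧ x 3) → ¬ (x 0 ∧ x 1 ∧ x 3) → bitCount x ≤ 2 := by decide
  apply hbits <;> simp only [pattern, decide_eq_true_eq] <;> rintro ⟨h1, h2, h3⟩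
  · exact (h 1 h2).not_three h1 h3
  · exact (h 2 h2).not_three h1 h3
  · exact (h 2 h2).not_pair_left h1 h3
  · exact (h 1 h2).not_pair_right h1 h3

end Rows

section Gadgets

variable {q n m : ℕ} {φ : QCSP q n m} {D : Set (CVert q n m φ.C)}

/-- The vertices of `D` in the clique `K_j`. -/
def kPart (D : Set (CVert q n m φ.C)) (j : Fin (Fnum n * m)) : Set (CVert q n m φ.C) :=
  {v ∈ D | ∃ l a, v = .kvert j l a}

/-- The vertices of `D` in the clique `L_j`. -/
def lPart (D : Set (CVert q n m φ.C)) (j : Fin (Fnum n * m)) : Set (CVert q n m φ.C) :=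
  {v ∈ D | ∃ l a, v = .lvert j l a}

theorem eq_or_adj_kvert (j : Fin (Fnum n * m)) (l l' : Fin (φ.C (cIdx j)))
    (a a' : Fin (Anum q)) : (CVert.kvert j l a : CVert q n m φ.C) = .kvert j l' a' ∨
      (cspGraph q n m φ).Adj (.kvert j l a) (.kvert j l' a') := by
  rw [adj_kvert_kvert]
  tauto

theorem eq_or_adj_lvert (j : Fin (Fnum n * m)) (l l' : Fin (φ.C (cIdx j)))
    (a a' : Fin (Anum q)) : (CVert.lvert j l a : CVert q n m φ.C) = .lvert j l' a' ∨
      (cspGraph q n m φ).Adj (.lvert j l a) (.lvert j l' a') := by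
  rw [adj_lvert_lvert]
  tauto

theorem exists_path_isPrivateNeighbor_kvert
    (hD : MinimalDominatingSet (cspGraph q n m φ) D) {j : Fin (Fnum n * m)}
    {x x' : CVert q n m φ.C} (hx : x ∈ kPart D j) (hx' : x' ∈ kPart D j) (hne : x' ≠ x) :
    ∃ pk : Fin q × Fin 4, ∃ h, IsPrivateNeighbor (cspGraph q n m φ) D x
      (.path (φ.vars (cIdx j) pk.1) ⟨4 * j.val + 3 + pk.2.val, h⟩) := by
  obtain ⟨hxD, l, a, rfl⟩ := hx
  obtain ⟨hxD', l', a', rfl⟩ := hx'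
  obtain ⟨v, hv⟩ := hD.exists_isPrivateNeighbor hxD
  rcases v with ⟨i, t⟩ | ⟨j₁, l₁, a₁⟩ | ⟨j₁, l₁, a₁⟩ | j₁
  · have h := hv.1
    simp only [reduceCtorEq, false_or, adj_kvert_path] at h
    obtain ⟨p, rfl, h⟩ := h
    have h1 := off1_lt (φ.sat (cIdx j) l p)
    have h2 := off2_lt (φ.sat (cIdx j) l p)
    have ht : 4 * j.val + 3 + (t.val - (4 * j.val + 3)) = t.val := by omega
    refine ⟨(p, ⟨t.val - (4 * j.val + 3), by omega⟩), by simp only [ht]; exact t.2, ?_⟩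
    simpa only [ht] using hv
  · obtain rfl : j₁ = j := by
      rcases hv.1 with h | h
      · simp only [CVert.kvert.injEq] at h
        exact h.1
      · exact (adj_kvert_kvert.1 h).2.symm
    exact absurd (hv.2 _ hxD' (eq_or_adj_kvert _ _ _ _ _)) hne
  · obtain rfl : j = j₁ := by
      have h := hv.1
      simp only [reduceCtorEq, false_or, adj_kvert_lvert] at h
      exact h.1
    rcases hD.1 (.wvert j) with hw | ⟨u, hu, huw⟩
    · have := hv.2 _ hw (Or.inr (by simp))
      simp at this
    · rcases u with _ | _ | ⟨j₂, l₂, a₂⟩ | _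
      · simp at huw
      · simp at huw
      · obtain rfl := adj_lvert_wvert.1 huw
        have := hv.2 _ hu (eq_or_adj_lvert _ _ _ _ _)
        simp at this
      · simp at huw
  · simpa using hv.1

theorem exists_kvert_isPrivateNeighbor_lvert
    (hD : MinimalDominatingSet (cspGraph q n m φ) D) {j : Fin (Fnum n * m)}
    {x x' : CVert q n m φ.C} (hx : x ∈ lPart D j) (hx' : x' ∈ lPart D j) (hne : x' ≠ x) :
    ∃ l a, IsPrivateNeighbor (cspGraph q n m φ) D x (.kvert j l a) := by
  obtain ⟨hxD, l, a, rfl⟩ := hx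
  obtain ⟨hxD', l', a', rfl⟩ := hx'
  obtain ⟨v, hv⟩ := hD.exists_isPrivateNeighbor hxD
  rcases v with ⟨i, t⟩ | ⟨j₁, l₁, a₁⟩ | ⟨j₁, l₁, a₁⟩ | j₁
  · simpa using hv.1
  · obtain rfl : j₁ = j := by
      have h := hv.1
      simp only [reduceCtorEq, false_or, adj_lvert_kvert] at h
      exact h.1
    exact ⟨l₁, a₁, hv⟩
  · obtain rfl : j₁ = j := by
      rcases hv.1 with h | h
      · simp only [CVert.lvert.injEq] at h
        exact h.1
      · exact (adj_lvert_lvert.1 h).2.symm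
    exact absurd (hv.2 _ hxD' (eq_or_adj_lvert _ _ _ _ _)) hne
  · obtain rfl : j₁ = j := by
      have h := hv.1
      simp only [reduceCtorEq, false_or, adj_lvert_wvert] at h
      exact h
    exact absurd (hv.2 _ hxD' (Or.inr (by simp))) hne

theorem kPart_ncard_le (hD : MinimalDominatingSet (cspGraph q n m φ) D) (hq : 0 < q)
    (j : Fin (Fnum n * m)) : (kPart D j).ncard ≤ 4 * q := by
  by_cases hs : (kPart D j).Subsingleton
  · have := Set.ncard_le_one_iff_subsingleton.2 hs
    omega
  have hpriv : ∀ x ∈ kPart D j, ∃ pk : Fin q × Fin 4, ∃ h,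
      IsPrivateNeighbor (cspGraph q n m φ) D x
        (.path (φ.vars (cIdx j) pk.1) ⟨4 * j.val + 3 + pk.2.val, h⟩) := by
    intro x hx
    obtain ⟨x', hx', hne⟩ := (Set.not_subsingleton_iff.1 hs).exists_ne x
    exact exists_path_isPrivateNeighbor_kvert hD hx hx' hne
  have : Nonempty (Fin q × Fin 4) := ⟨(⟨0, hq⟩, 0)⟩
  choose! f hf using hpriv
  have hinj : Set.InjOn f (kPart D j) := by
    intro x hx x' hx' hxx
    obtain ⟨h1, hp1⟩ := hf x hx
    obtain ⟨h2, hp2⟩ := hf x' hx'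
    simp only [← hxx] at hp2
    exact (hp2.eq hp1 hx.1)
  have := Set.ncard_le_ncard_of_injOn f (t := Set.univ) (fun _ _ => Set.mem_univ _) hinj
  rw [Set.ncard_univ, Nat.card_eq_fintype_card, Fintype.card_prod, Fintype.card_fin,
    Fintype.card_fin] at this
  omega

theorem lPart_subsingleton_of_kPart_nonempty
    (hD : MinimalDominatingSet (cspGraph q n m φ) D) {j : Fin (Fnum n * m)}
    (hK : (kPart D j).Nonempty) : (lPart D j).Subsingleton := by
  obtain ⟨_, hyD, l, a, rfl⟩ := hK
  intro x hx x' hx'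
  by_contra hne
  obtain ⟨l₁, a₁, hv⟩ := exists_kvert_isPrivateNeighbor_lvert hD hx hx' (Ne.symm hne)
  obtain ⟨-, l₂, a₂, rfl⟩ := hx
  have := hv.2 _ hyD (eq_or_adj_kvert _ _ _ _ _)
  simp at this

theorem lPart_subsingleton_of_path_private
    (hD : MinimalDominatingSet (cspGraph q n m φ) D) {j : Fin (Fnum n * m)} {i : Fin n}
    {t : Fin (4 * (Fnum n * m) + 6)} {l : Fin (φ.C (cIdx j))} {a : Fin (Anum q)}
    (hu : CVert.path i t ∈ D)
    (h : IsPrivateNeighbor (cspGraph q n m φ) D (.path i t) (.kvert j l a)) :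
    (lPart D j).Subsingleton := by
  have hl : ∀ l' a', CVert.lvert j l' a' ∈ D → l = l' := by
    intro l' a' hD'
    by_contra hne
    have := h.2 _ hD' (Or.inr (by
      rw [adj_lvert_kvert]
      exact ⟨rfl, fun h => absurd (Fin.ext h) hne⟩))
    simp at this
  intro x hx x' hx'
  by_contra hne
  obtain ⟨l₁, a₁, hv⟩ := exists_kvert_isPrivateNeighbor_lvert hD hx hx' (Ne.symm hne)
  obtain ⟨hxD, l₂, a₂, rfl⟩ := hx
  obtain ⟨hxD', l₃, a₃, rfl⟩ := hx'
  obtain rfl := hl _ _ hxD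
  obtain rfl := hl _ _ hxD'
  by_cases hll : l₁ = l
  · subst hll
    have := hv.2 _ hu (Or.inr (by
      have h := h.1
      simp only [reduceCtorEq, false_or, adj_path_kvert] at h ⊢
      exact h))
    simp at this
  · exact hne (hv.2 _ hxD' (Or.inr (by
      rw [adj_lvert_kvert]
      exact ⟨rfl, fun h => absurd (Fin.ext h) hll⟩))).symm

theorem wvert_notMem_of_lPart_nonempty (hD : MinimalDominatingSet (cspGraph q n m φ) D)
    {j : Fin (Fnum n * m)} (hL : (lPart D j).Nonempty) : CVert.wvert j ∉ D := by
  obtain ⟨_, hyD, l, a, rfl⟩ := hL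
  intro hw
  obtain ⟨v, hv⟩ := hD.exists_isPrivateNeighbor hw
  rcases v with _ | _ | ⟨j₁, l₁, a₁⟩ | j₁
  · simpa using hv.1
  · simpa using hv.1
  · obtain rfl : j = j₁ := by simpa using hv.1
    have := hv.2 _ hyD (eq_or_adj_lvert _ _ _ _ _)
    simp at this
  · obtain rfl : j₁ = j := by simpa using hv.1
    have := hv.2 _ hyD (Or.inr (by simp))
    simp at this

/-- As soon as `D` has three vertices in `L_j`, each of them has its match as a private
neighbor. -/
theorem isPrivateNeighbor_match_of_three_le
    (hD : MinimalDominatingSet (cspGraph q n m φ) D) {j : Fin (Fnum n * m)}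
    (h3 : 3 ≤ (lPart D j).ncard) {l : Fin (φ.C (cIdx j))} {a : Fin (Anum q)}
    (hx : CVert.lvert j l a ∈ D) :
    IsPrivateNeighbor (cspGraph q n m φ) D (.lvert j l a) (.kvert j l a) := by
  have hxL : CVert.lvert j l a ∈ lPart D j := ⟨hx, l, a, rfl⟩
  obtain ⟨z, hz, hzx⟩ := Set.exists_ne_of_one_lt_ncard (by omega : 1 < (lPart D j).ncard)
    (CVert.lvert j l a)
  obtain ⟨l₂, a₂, hv⟩ := exists_kvert_isPrivateNeighbor_lvert hD hxL hz hzx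
  by_cases hl : l₂ = l
  · subst hl
    have h := hv.1
    simp only [reduceCtorEq, false_or, adj_lvert_kvert, true_and, forall_const] at h
    rwa [h] at hv
  exfalso
  have hside : ∀ l' a', CVert.lvert j l' a' ∈ D →
      (CVert.lvert j l' a' : CVert q n m φ.C) ≠ .lvert j l a → l' = l₂ := by
    intro l' a' hD' hne
    by_contra hll
    exact hne (hv.2 _ hD' (Or.inr (by
      rw [adj_lvert_kvert]
      exact ⟨rfl, fun h => absurd (Fin.ext h.symm) hll⟩)))
  obtain ⟨l₃, a₃, hv'⟩ := exists_kvert_isPrivateNeighbor_lvert hD hz hxL (Ne.symm hzx)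
  obtain ⟨hzD, lz, az, rfl⟩ := hz
  obtain rfl := hside _ _ hzD hzx
  have hll : l₃ ≠ lz := by
    rintro rfl
    exact hzx (hv'.2 _ hx (Or.inr (by
      rw [adj_lvert_kvert]
      exact ⟨rfl, fun h => absurd (Fin.ext h) hl⟩))).symm
  have hsub : lPart D j ⊆ {CVert.lvert j l a, CVert.lvert j lz az} := by
    rintro _ ⟨hyD, ly, ay, rfl⟩
    by_cases hy : (CVert.lvert j ly ay : CVert q n m φ.C) = .lvert j l a
    · exact Or.inl hy
    · obtain rfl := hside _ _ hyD hy
      exact Or.inr (hv'.2 _ hyD (Or.inr (by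
        rw [adj_lvert_kvert]
        exact ⟨rfl, fun h => absurd (Fin.ext h) hll⟩)))
  have hle := Set.ncard_le_ncard hsub
  rw [Set.ncard_pair hzx.symm] at hle
  omega

theorem lPart_subset_range_of_three_le
    (hD : MinimalDominatingSet (cspGraph q n m φ) D) {j : Fin (Fnum n * m)}
    (h3 : 3 ≤ (lPart D j).ncard) {l : Fin (φ.C (cIdx j))} {a : Fin (Anum q)}
    (hx : CVert.lvert j l a ∈ D) :
    lPart D j ⊆ Set.range (fun a' => (CVert.lvert j l a' : CVert q n m φ.C)) := by
  rintro _ ⟨hyD, l', a', rfl⟩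
  by_cases hll : l' = l
  · exact ⟨a', by rw [hll]⟩
  · have := (isPrivateNeighbor_match_of_three_le hD h3 hx).2 _ hyD (Or.inr (by
      rw [adj_lvert_kvert]
      exact ⟨rfl, fun h => absurd (Fin.ext h.symm) hll⟩))
    simp only [CVert.lvert.injEq, heq_eq_eq, true_and] at this
    exact absurd this.1 hll

theorem lPart_ncard_le (hD : MinimalDominatingSet (cspGraph q n m φ) D) (hq : 0 < q)
    (j : Fin (Fnum n * m)) : (lPart D j).ncard ≤ Anum q := by
  by_cases h3 : 3 ≤ (lPart D j).ncard
  · obtain ⟨_, hx, l, a, rfl⟩ := Set.nonempty_of_ncard_ne_zero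
      (by omega : (lPart D j).ncard ≠ 0)
    refine (Set.ncard_le_ncard (lPart_subset_range_of_three_le hD h3 hx)).trans ?_
    rw [← Set.image_univ]
    refine (Set.ncard_image_le).trans ?_
    simp [Set.ncard_univ]
  · unfold Anum
    omega

end Gadgets

section Sections

variable {q n m : ℕ} {φ : QCSP q n m} {D : Set (CVert q n m φ.C)}

/-- The section of a vertex: `j + 1` for the vertices attached to `H_j`, and `0` and
`Fm + 1` for the first and last three vertices of each path. -/
def sectionIndex {C : Fin m → ℕ} : CVert q n m C → ℕ
  | .path _ t => (t.val + 1) / 4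
  | .kvert j _ _ => j.val + 1
  | .lvert j _ _ => j.val + 1
  | .wvert j => j.val + 1

/-- The vertices of `D` in a given section. -/
def sectionPart (D : Set (CVert q n m φ.C)) (s : ℕ) : Set (CVert q n m φ.C) :=
  {v ∈ D | sectionIndex v = s}

/-- The vertices of `D` in a given section of the path of `i`. -/
def rowPart (D : Set (CVert q n m φ.C)) (i : Fin n) (s : ℕ) : Set (CVert q n m φ.C) :=
  {v ∈ D | ∃ t, v = .path i t ∧ (t.val + 1) / 4 = s}

theorem ncard_eq_sum_sectionPart (D : Set (CVert q n m φ.C)) :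
    D.ncard = ∑ s ∈ Finset.range (Fnum n * m + 2), (sectionPart D s).ncard := by
  classical
  have hfin : D.Finite := D.toFinite
  rw [Set.ncard_eq_toFinset_card D hfin, Finset.card_eq_sum_card_fiberwise
    (f := sectionIndex) (t := Finset.range (Fnum n * m + 2))]
  · refine Finset.sum_congr rfl fun s _ => ?_
    rw [← Set.ncard_coe_finset]
    congr 1
    ext v
    simp [sectionPart]
  · intro v _
    simp only [Finset.coe_range, Set.mem_Iio]
    cases v <;> simp only [sectionIndex] <;> omega

open Classical in
theorem rowPart_ncard_le {i : Fin n} {s base len : ℕ}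
    (h : ∀ t, t < 4 * (Fnum n * m) + 6 → (t + 1) / 4 = s → base ≤ t ∧ t < base + len) :
    (rowPart D i s).ncard ≤
      ∑ k ∈ Finset.range len, if RowMem D i (base + k) then 1 else 0 := by
  rw [← Finset.card_filter, ← Set.ncard_coe_finset]
  let f : CVert q n m φ.C → ℕ := fun v => match v with
    | .path _ t => t.val - base
    | _ => 0
  refine Set.ncard_le_ncard_of_injOn f ?_ ?_ (Finset.finite_toSet _)
  · rintro _ ⟨hD, t, rfl, ht⟩
    have := h t t.2 ht
    have hb : base + (t.val - base) = t.val := by omega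
    simp only [f, Finset.coe_filter, Finset.mem_range, Set.mem_ofPred_eq, hb]
    exact ⟨by omega, t.2, hD⟩
  · rintro _ ⟨-, t, rfl, ht⟩ _ ⟨-, t', rfl, ht'⟩ heq
    have h1 := h t t.2 ht
    have h2 := h t' t'.2 ht'
    simp only [f] at heq
    simp only [CVert.path.injEq, true_and]
    ext
    omega

theorem rowPart_ncard_le_bitCount (i : Fin n) (j : Fin (Fnum n * m)) :
    (rowPart D i (j + 1)).ncard ≤ bitCount (pattern D i j) := by
  classical
  refine (rowPart_ncard_le (base := 4 * j + 3) (len := 4) (by omega)).trans_eq ?_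
  rw [bitCount, ← Fin.sum_univ_eq_sum_range
    (fun k => if RowMem D i (4 * j.val + 3 + k) then 1 else 0)]
  refine Finset.sum_congr rfl fun k _ => ?_
  by_cases hk : RowMem D i (4 * j.val + 3 + k) <;> simp [pattern, hk]

theorem not_rowMem_three (hD : MinimalDominatingSet (cspGraph q n m φ) D) {i : Fin n}
    {t : ℕ} (ht : t + 1 < 3 ∨ 4 * (Fnum n * m) + 3 ≤ t + 1) (h0 : RowMem D i t)
    (h1 : RowMem D i (t + 1)) (h2 : RowMem D i (t + 2)) : False := by
  obtain ⟨h, hmem⟩ := h1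
  rcases hasRowPrivate_or_kvert hD hmem with hp | ⟨j, l, a, hp⟩
  · exact hp.not_three h0 h2
  · have hb : 4 * j.val + 3 ≤ t + 1 ∧ t + 1 < 4 * j.val + 7 := hp.path_kvert_bounds.2
    have := j.2
    omega

theorem rowPart_end_ncard_le (hD : MinimalDominatingSet (cspGraph q n m φ) D) (i : Fin n)
    {s : ℕ} (hs : s = 0 ∨ s = Fnum n * m + 1) : (rowPart D i s).ncard ≤ 2 := by
  classical
  have hsum : ∀ base, base = 0 ∨ base = 4 * (Fnum n * m) + 3 →
      ∑ k ∈ Finset.range 3, (if RowMem D i (base + k) then 1 else 0) ≤ 2 := by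
    intro base hb
    have := @not_rowMem_three q n m φ D hD i base (by omega)
    simp only [Finset.sum_range_succ, Finset.sum_range_zero, add_zero]
    split_ifs <;> first | omega | (exfalso; tauto)
  rcases hs with rfl | rfl
  · exact (rowPart_ncard_le (base := 0) (len := 3) (by omega)).trans (hsum 0 (Or.inl rfl))
  · exact (rowPart_ncard_le (base := 4 * (Fnum n * m) + 3) (len := 3) (by omega)).trans
      (hsum _ (Or.inr rfl))

theorem sectionPart_end_ncard_le (hD : MinimalDominatingSet (cspGraph q n m φ) D)
    {s : ℕ} (hs : s = 0 ∨ s = Fnum n * m + 1) : (sectionPart D s).ncard ≤ 2 * n := by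
  have hsub : sectionPart D s ⊆ ⋃ i, rowPart D i s := by
    rintro v ⟨hv, hvs⟩
    rcases v with ⟨i, t⟩ | ⟨j, l, a⟩ | ⟨j, l, a⟩ | j <;> simp only [sectionIndex] at hvs
    · exact Set.mem_iUnion.2 ⟨i, hv, t, rfl, hvs⟩
    all_goals omega
  calc (sectionPart D s).ncard ≤ (⋃ i, rowPart D i s).ncard := Set.ncard_le_ncard hsub
    _ ≤ ∑ i, (rowPart D i s).ncard := Set.ncard_iUnion_le_of_fintype _
    _ ≤ ∑ _i : Fin n, 2 := Finset.sum_le_sum fun i _ => rowPart_end_ncard_le hD i hs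
    _ = 2 * n := by simp [mul_comm]

theorem sectionPart_ncard_le (j : Fin (Fnum n * m)) :
    (sectionPart D (j + 1)).ncard ≤ (kPart D j).ncard + (lPart D j).ncard +
      (D ∩ {.wvert j}).ncard + ∑ i, bitCount (pattern D i j) := by
  have hsub : sectionPart D (j + 1) ⊆
      ((kPart D j ∪ lPart D j) ∪ (D ∩ {.wvert j})) ∪ ⋃ i, rowPart D i (j + 1) := by
    rintro v ⟨hv, hvs⟩
    rcases v with ⟨i, t⟩ | ⟨j', l, a⟩ | ⟨j', l, a⟩ | j' <;> simp only [sectionIndex] at hvs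
    · exact Or.inr (Set.mem_iUnion.2 ⟨i, hv, t, rfl, hvs⟩)
    all_goals obtain rfl : j' = j := Fin.ext (by omega)
    · exact Or.inl (Or.inl (Or.inl ⟨hv, l, a, rfl⟩))
    · exact Or.inl (Or.inl (Or.inr ⟨hv, l, a, rfl⟩))
    · exact Or.inl (Or.inr ⟨hv, rfl⟩)
  refine (Set.ncard_le_ncard hsub).trans ((Set.ncard_union_le _ _).trans ?_)
  gcongr
  · refine (Set.ncard_union_le _ _).trans ?_
    gcongr
    exact Set.ncard_union_le _ _
  · exact (Set.ncard_iUnion_le_of_fintype _).trans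
      (Finset.sum_le_sum fun i _ => rowPart_ncard_le_bitCount i j)

/-- Section `j` is tight: `D` avoids `K_j`, and on every path it selects two of the four
vertices, which have private neighbors on the path and realize a satisfying assignment. -/
def IsTight (D : Set (CVert q n m φ.C)) (j : Fin (Fnum n * m)) : Prop :=
  (∀ l a, CVert.kvert j l a ∉ D) ∧
  (∃ l, ∀ p, pattern D (φ.vars (cIdx j) p) j ⟨_, off1_lt (φ.sat (cIdx j) l p)⟩ = false ∧
    pattern D (φ.vars (cIdx j) p) j ⟨_, off2_lt (φ.sat (cIdx j) l p)⟩ = false) ∧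
  (∀ i (k : Fin 4), RowMem D i (4 * j + 3 + k) →
    HasRowPrivate (RowMem D i) (4 * j + 3 + k)) ∧
  ∀ i, bitCount (pattern D i j) = 2

theorem wvert_inter_ncard_le_one (j : Fin (Fnum n * m)) :
    (D ∩ {.wvert j}).ncard ≤ 1 :=
  (Set.ncard_le_ncard Set.inter_subset_right).trans (Set.ncard_singleton _).le

theorem lPart_add_wvert_le_one (hD : MinimalDominatingSet (cspGraph q n m φ) D)
    {j : Fin (Fnum n * m)} (hL : (lPart D j).Subsingleton) :
    (lPart D j).ncard + (D ∩ {.wvert j}).ncard ≤ 1 := by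
  rcases (lPart D j).eq_empty_or_nonempty with h | h
  · rw [h, Set.ncard_empty, zero_add]
    exact wvert_inter_ncard_le_one j
  · have hw : D ∩ {.wvert j} = ∅ := by
      rw [Set.inter_singleton_eq_empty]
      exact wvert_notMem_of_lPart_nonempty hD h
    rw [hw, Set.ncard_empty, add_zero]
    exact Set.ncard_le_one_iff_subsingleton.2 hL

/-- A section in which some path vertex of `D` has a private neighbor in `K_j` is deficient. -/
theorem sectionPart_ncard_lt_of_path_private
    (hD : MinimalDominatingSet (cspGraph q n m φ) D) (hq : 0 < q) {j : Fin (Fnum n * m)}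
    {i : Fin n} {t : Fin (4 * (Fnum n * m) + 6)} {l : Fin (φ.C (cIdx j))} {a : Fin (Anum q)}
    (hu : CVert.path i t ∈ D)
    (h : IsPrivateNeighbor (cspGraph q n m φ) D (.path i t) (.kvert j l a)) :
    (sectionPart D (j + 1)).ncard < 2 * n + Anum q := by
  classical
  have hK : kPart D j = ∅ := by
    rw [Set.eq_empty_iff_forall_notMem]
    rintro _ ⟨hy, l', a', rfl⟩
    have := h.2 _ hy (eq_or_adj_kvert _ _ _ _ _)
    simp at this
  have hLW := lPart_add_wvert_le_one hD (lPart_subsingleton_of_path_private hD hu h)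
  have hrow : ∀ i, bitCount (pattern D i j) ≤
      2 + if i ∈ Finset.univ.image (φ.vars (cIdx j)) then 2 else 0 := by
    intro i'
    split_ifs with hi
    · exact bitCount_le_four _
    · refine bitCount_pattern_le_two fun k ⟨hk, hmem⟩ => ?_
      rcases hasRowPrivate_or_kvert hD hmem with hp | ⟨j', l', a', hp⟩
      · exact hp
      · obtain ⟨⟨p, hpi⟩, hb⟩ := hp.path_kvert_bounds
        obtain rfl : j' = j := by
          ext
          simp only at hb
          omega
        exact absurd (Finset.mem_image.2 ⟨p, Finset.mem_univ _, hpi⟩) hi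
  have hsum := Finset.sum_le_sum fun i (_ : i ∈ Finset.univ) => hrow i
  have hcard : (Finset.univ.image (φ.vars (cIdx j))).card ≤ q :=
    Finset.card_image_le.trans (by simp)
  rw [Finset.sum_add_distrib, Finset.sum_ite_mem] at hsum
  simp only [Finset.univ_inter, Finset.sum_const, Finset.card_univ, Fintype.card_fin,
    smul_eq_mul] at hsum
  have hle := sectionPart_ncard_le (D := D) j
  rw [hK, Set.ncard_empty] at hle
  unfold Anum
  omega

theorem sectionPart_ncard_le_of_forall_hasRowPrivate
    (hD : MinimalDominatingSet (cspGraph q n m φ) D) (hq : 0 < q) {j : Fin (Fnum n * m)}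
    (h : ∀ i (k : Fin 4), RowMem D i (4 * j + 3 + k) →
      HasRowPrivate (RowMem D i) (4 * j + 3 + k)) :
    (sectionPart D (j + 1)).ncard ≤ 2 * n + Anum q ∧
      ((sectionPart D (j + 1)).ncard = 2 * n + Anum q → IsTight D j) := by
  have hle := sectionPart_ncard_le (D := D) j
  have htwo : ∀ i, bitCount (pattern D i j) ≤ 2 := fun i => bitCount_pattern_le_two (h i)
  have hsum : ∑ i, bitCount (pattern D i j) ≤ 2 * n := by
    refine (Finset.sum_le_sum fun i _ => htwo i).trans ?_
    simp [mul_comm]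
  have hA : Anum q = 4 * q + 2 := rfl
  rcases (kPart D j).eq_empty_or_nonempty with hK | hK
  · rw [hK, Set.ncard_empty] at hle
    by_cases h3 : 3 ≤ (lPart D j).ncard
    · have hLne : (lPart D j).Nonempty := Set.nonempty_of_ncard_ne_zero (by omega)
      have hw : D ∩ {.wvert j} = ∅ := by
        rw [Set.inter_singleton_eq_empty]
        exact wvert_notMem_of_lPart_nonempty hD hLne
      have hL := lPart_ncard_le hD hq j
      rw [hw, Set.ncard_empty] at hle
      refine ⟨by omega, fun heq => ⟨fun l a hmem => ?_, ?_, h, ?_⟩⟩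
      · have : CVert.kvert j l a ∈ kPart D j := ⟨hmem, l, a, rfl⟩
        simp [hK] at this
      · obtain ⟨_, hx, l, a, rfl⟩ := hLne
        have hp := isPrivateNeighbor_match_of_three_le hD h3 hx
        refine ⟨l, fun p => ?_⟩
        have hnot : ∀ o, o = off1 (φ.sat (cIdx j) l p) ∨ o = off2 (φ.sat (cIdx j) l p) →
            ¬ RowMem D (φ.vars (cIdx j) p) (4 * j + 3 + o) := by
          rintro o ho ⟨ht, hmem⟩
          have := hp.2 _ hmem (Or.inr (by
            rw [adj_path_kvert]
            exact ⟨p, rfl, by simp only; omega⟩))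
          simp at this
        exact ⟨by simpa [pattern] using hnot _ (Or.inl rfl),
          by simpa [pattern] using hnot _ (Or.inr rfl)⟩
      · intro i
        have hall : ∑ i, bitCount (pattern D i j) = ∑ _i : Fin n, 2 := by
          simp only [Finset.sum_const, Finset.card_univ, Fintype.card_fin, smul_eq_mul]
          omega
        exact (Finset.sum_eq_sum_iff_of_le fun i _ => htwo i).1 hall i (Finset.mem_univ i)
    · have := wvert_inter_ncard_le_one (D := D) j
      constructor <;> omega
  · have hLW := lPart_add_wvert_le_one hD (lPart_subsingleton_of_kPart_nonempty hD hK)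
    have := kPart_ncard_le hD hq j
    constructor <;> omega

open Classical in
theorem sectionPart_ncard_add_le (hD : MinimalDominatingSet (cspGraph q n m φ) D)
    (hq : 0 < q) (j : Fin (Fnum n * m)) :
    (sectionPart D (j + 1)).ncard + (if IsTight D j then 0 else 1) ≤ 2 * n + Anum q := by
  by_cases h : ∀ i (k : Fin 4), RowMem D i (4 * j + 3 + k) →
      HasRowPrivate (RowMem D i) (4 * j + 3 + k)
  · obtain ⟨h1, h2⟩ := sectionPart_ncard_le_of_forall_hasRowPrivate hD hq h
    split_ifs with ht
    · exact h1
    · have := mt h2 ht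
      omega
  · push Not at h
    obtain ⟨i, k, ⟨hk, hmem⟩, hnp⟩ := h
    rcases hasRowPrivate_or_kvert hD hmem with hp | ⟨j', l, a, hp⟩
    · exact absurd hp hnp
    · obtain rfl : j' = j := by
        have := hp.path_kvert_bounds.2
        ext
        simp only at this
        omega
      have := sectionPart_ncard_lt_of_path_private hD hq hmem hp
      split_ifs <;> omega

open Classical in
/-- A minimal dominating set reaching the budget has at most `2n` sections that are not
tight. -/
theorem card_not_isTight_le (hD : MinimalDominatingSet (cspGraph q n m φ) D) (hq : 0 < q)
    (hk : budget q n m ≤ D.ncard) :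
    (Finset.univ.filter fun j => ¬ IsTight D j).card ≤ 2 * n := by
  rw [ncard_eq_sum_sectionPart, Finset.sum_range_succ, Finset.sum_range_succ'] at hk
  have h0 := sectionPart_end_ncard_le hD (Or.inl (rfl : 0 = 0))
  have h1 := sectionPart_end_ncard_le hD (Or.inr (rfl : Fnum n * m + 1 = _))
  have hsum := Finset.sum_le_sum fun j (_ : j ∈ Finset.univ) =>
    sectionPart_ncard_add_le hD hq j
  rw [Finset.sum_add_distrib, Fin.sum_univ_eq_sum_range (fun s => (sectionPart D (s + 1)).ncard),
    Finset.sum_const, Finset.card_univ, Fintype.card_fin, smul_eq_mul] at hsum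
  have hcard : (Finset.univ.filter fun j => ¬ IsTight D j).card =
      ∑ j, if IsTight D j then 0 else 1 := by
    rw [Finset.card_filter]
    exact Finset.sum_congr rfl fun j _ => by split_ifs <;> rfl
  unfold budget at hk
  omega

end Sections

section Tight

variable {q n m : ℕ} {φ : QCSP q n m} {D : Set (CVert q n m φ.C)}

theorem IsTight.rowMem_near (hD : MinimalDominatingSet (cspGraph q n m φ) D)
    {j : Fin (Fnum n * m)} (hj : IsTight D j) (i : Fin n) {u : ℕ} (h1 : 4 * j.val + 3 ≤ u + 1)
    (h2 : u < 4 * j.val + 6) :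
    RowMem D i u ∨ RowMem D i (u + 1) ∨ RowMem D i (u + 2) := by
  have hu : u + 1 < 4 * (Fnum n * m) + 6 := by omega
  rcases hD.1 (.path i ⟨u + 1, hu⟩) with h | ⟨v, hv, hadj⟩
  · exact Or.inr (Or.inl ⟨hu, h⟩)
  · rcases v with ⟨i', t⟩ | ⟨j', l, a⟩ | _ | _
    · simp only [adj_path_path] at hadj
      obtain ⟨rfl, h | h⟩ := hadj
      · have ht : u = t.val := by omega
        exact Or.inl ⟨by omega, by simpa [ht] using hv⟩
      · exact Or.inr (Or.inr ⟨by omega, by simpa [← h] using hv⟩)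
    · simp only [adj_kvert_path] at hadj
      obtain ⟨p, -, h⟩ := hadj
      have h1 := off1_lt (φ.sat (cIdx j') l p)
      have h2 := off2_lt (φ.sat (cIdx j') l p)
      obtain rfl : j' = j := by
        ext
        omega
      exact absurd hv (hj.1 l a)
    · simp at hadj
    · simp at hadj

theorem HasRowPrivate.of_interior {b : ℕ → Prop} {t : ℕ} (h : HasRowPrivate b (t + 2)) :
    (¬ b (t + 1) ∧ ¬ b (t + 3)) ∨ (¬ b (t + 3) ∧ ¬ b (t + 4)) ∨ (¬ b (t + 1) ∧ ¬ b t) := by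
  rcases h with ⟨h1, h2⟩ | h | ⟨s, hs, h1, h2⟩
  · exact Or.inl ⟨h2 _ rfl, h1⟩
  · exact Or.inr (Or.inl h)
  · obtain rfl : s = t + 1 := by omega
    exact Or.inr (Or.inr ⟨h1, h2 t rfl⟩)

theorem IsTight.patternRank_le_succ (hD : MinimalDominatingSet (cspGraph q n m φ) D)
    {j j' : Fin (Fnum n * m)} (hjj : j'.val = j.val + 1) (hj : IsTight D j)
    (hj' : IsTight D j') (i : Fin n) :
    patternRank (pattern D i j) ≤ patternRank (pattern D i j') ∧
      (patternRank (pattern D i j) = patternRank (pattern D i j') →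
        pattern D i j = pattern D i j') := by
  classical
  let r := 4 * j.val + 3
  let b : ℕ → Bool := fun k => decide (RowMem D i (r + k))
  have hp : pattern D i j = ![b 0, b 1, b 2, b 3] := by
    funext k
    fin_cases k <;> simp [pattern, b, r]
  have hr : 4 * j'.val + 3 = r + 4 := by omega
  have hp' : pattern D i j' = ![b 4, b 5, b 6, b 7] := by
    funext k
    simp only [pattern, hr]
    fin_cases k <;> simp [b, add_assoc]
  have hdom : ∀ k, 0 < k → k < 7 → b (k - 1) || b k || b (k + 1) := by
    intro k hk hk7
    obtain ⟨k, rfl⟩ := Nat.exists_eq_succ_of_ne_zero hk.ne'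
    have : RowMem D i (r + k) ∨ RowMem D i (r + k + 1) ∨ RowMem D i (r + k + 2) := by
      by_cases h4 : k + 1 < 4
      · exact hj.rowMem_near hD i (by omega) (by omega)
      · exact hj'.rowMem_near hD i (by omega) (by omega)
    simpa [b, or_assoc, add_assoc] using this
  have hpriv : ∀ k, k < 4 → b (k + 2) →
      (!b (k + 1) && !b (k + 3)) || (!b (k + 3) && !b (k + 4)) || (!b (k + 1) && !b k) := by
    intro k hk hb
    have hmem : RowMem D i (r + k + 2) := by simpa [b, add_assoc] using hb
    have : HasRowPrivate (RowMem D i) (r + k + 2) := by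
      by_cases h2 : k < 2
      · exact hj.2.2.1 i ⟨k + 2, by omega⟩ hmem
      · have hrk : 4 * j'.val + 3 + (k - 2) = r + k + 2 := by omega
        have := hj'.2.2.1 i ⟨k - 2, by omega⟩
        simp only [hrk] at this
        exact this hmem
    simpa [b, or_assoc, add_assoc] using this.of_interior
  have hc := hj.2.2.2 i
  have hc' := hj'.2.2.2 i
  simp only [hp, hp', bitCount, Fin.sum_univ_four] at hc hc'
  have := patternRank_mono_aux (b 0) (b 1) (b 2) (b 3) (b 4) (b 5) (b 6) (b 7) hc hc'
    (hdom 2 (by omega) (by omega)) (hdom 3 (by omega) (by omega))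
    (hdom 4 (by omega) (by omega)) (hdom 5 (by omega) (by omega))
    (hpriv 0 (by omega)) (hpriv 1 (by omega)) (hpriv 2 (by omega)) (hpriv 3 (by omega))
  rw [hp, hp']
  refine ⟨this.1, fun h => ?_⟩
  obtain ⟨h1, h2, h3, h4⟩ := this.2 h
  rw [h1, h2, h3, h4]

/-- A sequence of consecutive tight sections covering all constraints, along which the
patterns do not change, yields a satisfying assignment. -/
theorem satisfiable_of_constant_pattern {a s : ℕ} (ha : a = s * m)
    (hle : a + m ≤ Fnum n * m) (x : Fin n → Fin 4 → Bool)
    (h : ∀ j : Fin (Fnum n * m), a ≤ j → j.val < a + m →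
      IsTight D j ∧ ∀ i, pattern D i j = x i) : φ.Satisfiable := by
  refine ⟨fun i => patternValue (x i), fun c => ?_⟩
  let j : Fin (Fnum n * m) := ⟨a + c, by omega⟩
  have hc : cIdx j = c := by
    ext
    simp [cIdx, j, ha, Nat.mod_eq_of_lt c.2]
  obtain ⟨hj, hx⟩ := h j (by simp [j]) (by simp [j])
  have hval : ∃ l, ∀ p, patternValue (x (φ.vars (cIdx j) p)) = φ.sat (cIdx j) l p := by
    obtain ⟨l, hl⟩ := hj.2.1
    refine ⟨l, fun p => ?_⟩
    rw [← hx]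
    exact patternValue_eq _ _ (hj.2.2.2 _) (hl p).1 (hl p).2
  exact hc ▸ hval

end Tight

theorem exists_block_disjoint {N K M : ℕ} {bad : Finset (Fin N)}
    (hbad : bad.card ≤ K) :
    ∃ s ≤ K, ∀ j : Fin N, s * M ≤ j → j.val < (s + 1) * M → j ∉ bad := by
  by_contra! hcon
  have hcon : ∀ s : Fin (K + 1), ∃ j : Fin N, s * M ≤ j ∧ j.val < (s + 1) * M ∧ j ∈ bad :=
    fun s => hcon s (by omega)
  choose f hf1 hf2 hf3 using hcon
  have hinj : Function.Injective f := by
    intro s s' hss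
    have h1 := Nat.div_eq_of_lt_le (hf1 s) (hf2 s)
    have h2 := Nat.div_eq_of_lt_le (hf1 s') (hf2 s')
    rw [hss] at h1
    exact Fin.ext (h1.symm.trans h2)
  have := Finset.card_le_card_of_injOn (s := Finset.univ) f (fun s _ => hf3 s) hinj.injOn
  rw [Finset.card_univ, Fintype.card_fin] at this
  omega

/-- A nondecreasing sequence bounded by `K` is constant on one of `K + 1` consecutive
blocks. -/
theorem exists_block_constant {R : ℕ → ℕ} {a m K : ℕ}
    (hmono : ∀ j, a ≤ j → j + 1 < a + (K + 1) * m → R j ≤ R (j + 1)) (hR : ∀ j, R j ≤ K) :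
    ∃ s ≤ K, ∀ j, a + s * m ≤ j → j + 1 < a + (s + 1) * m → R j = R (j + 1) := by
  by_contra! hcon
  have hmono' : ∀ j j', a ≤ j → j ≤ j' → j' < a + (K + 1) * m → R j ≤ R j' := by
    intro j j' hj hjj
    induction j', hjj using Nat.le_induction with
    | base => exact fun _ => le_rfl
    | succ k hk ih => exact fun hlt => (ih (by omega)).trans (hmono k (by omega) hlt)
  have hstep : ∀ s ≤ K, ∃ j, a ≤ j ∧ j < a + (s + 1) * m ∧ s + 1 ≤ R j := by
    intro s
    induction s with
    | zero =>
      intro hs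
      obtain ⟨j, h1, h2, hne⟩ := hcon 0 hs
      have hm : (0 + 1) * m ≤ (K + 1) * m := Nat.mul_le_mul_right m (by omega)
      have := hmono j (by omega) (by omega)
      exact ⟨j + 1, by omega, h2, by omega⟩
    | succ s ih =>
      intro hs
      obtain ⟨i, hi1, hi2, hi3⟩ := ih (by omega)
      obtain ⟨j, h1, h2, hne⟩ := hcon (s + 1) hs
      have hm : (s + 1 + 1) * m ≤ (K + 1) * m := Nat.mul_le_mul_right m (by omega)
      have := hmono' i j hi1 (by omega) (by omega)
      have := hmono j (by omega) (by omega)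
      exact ⟨j + 1, by omega, h2, by omega⟩
  obtain ⟨j, -, -, hj⟩ := hstep K le_rfl
  have := hR j
  omega

theorem stmt10 (q n m : ℕ) (φ : QCSP q n m)
    (hD : ∃ D : Set (CVert q n m φ.C), MinimalDominatingSet (cspGraph q n m φ) D ∧
      budget q n m ≤ D.ncard) :
    φ.Satisfiable := by
  classical
  obtain ⟨D, hD, hk⟩ := hD
  rcases Nat.eq_zero_or_pos q with rfl | hq
  · exact ⟨fun _ => 0, fun c => ⟨⟨0, φ.C_pos c⟩, fun p => p.elim0⟩⟩
  rcases Nat.eq_zero_or_pos m with rfl | hm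
  · exact ⟨fun _ => 0, fun c => c.elim0⟩
  obtain ⟨s, hs, hblock⟩ := exists_block_disjoint (K := 2 * n) (M := (4 * n + 1) * m)
    (card_not_isTight_le hD hq hk)
  have hend : (s + 1) * ((4 * n + 1) * m) ≤ Fnum n * m := by
    rw [Fnum, mul_assoc]
    exact Nat.mul_le_mul_right _ (by omega)
  rw [add_mul s, one_mul] at hend hblock
  generalize ha : s * ((4 * n + 1) * m) = a at hend hblock
  have htight : ∀ j : Fin (Fnum n * m), a ≤ j → j.val < a + (4 * n + 1) * m → IsTight D j := by
    intro j h1 h2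
    simpa using hblock j h1 h2
  have hrank : ∀ j, a ≤ j → j + 1 < a + (4 * n + 1) * m → ∀ i,
      patternRank (pattern D i j) ≤ patternRank (pattern D i (j + 1)) ∧
      (patternRank (pattern D i j) = patternRank (pattern D i (j + 1)) →
        pattern D i j = pattern D i (j + 1)) := fun j h1 h2 i =>
    IsTight.patternRank_le_succ hD (j := ⟨j, by omega⟩) (j' := ⟨j + 1, by omega⟩) rfl
      (htight _ h1 (by simp only; omega)) (htight _ (by simp only; omega) h2) i
  obtain ⟨r, hr, hconst⟩ := exists_block_constant (a := a) (m := m) (K := 4 * n)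
    (R := fun j => ∑ i, patternRank (pattern D i j))
    (fun j h1 h2 => Finset.sum_le_sum fun i _ => (hrank j h1 h2 i).1)
    (fun j => (Finset.sum_le_sum fun i _ => patternRank_le _).trans (by simp [mul_comm]))
  have hrm : (r + 1) * m ≤ (4 * n + 1) * m := Nat.mul_le_mul_right m (by omega)
  rw [add_mul r, one_mul] at hrm hconst
  have hpat : ∀ j, a + r * m ≤ j → j < a + r * m + m → ∀ i,
      pattern D i j = pattern D i (a + r * m) := by
    intro j hj
    induction j, hj using Nat.le_induction with
    | base => exact fun _ _ => rfl
    | succ k hk ih =>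
      intro hlt i
      have hmono := hrank k (by omega) (by omega)
      have heq := (Finset.sum_eq_sum_iff_of_le fun i _ => (hmono i).1).1
        (hconst k hk (by omega)) i (Finset.mem_univ i)
      rw [← (hmono i).2 heq]
      exact ih (by omega) i
  refine satisfiable_of_constant_pattern (D := D) (a := a + r * m) (s := s * (4 * n + 1) + r)
    (by rw [← ha]; ring) (by omega) (fun i => pattern D i (a + r * m)) fun j h1 h2 => ?_
  exact ⟨htight j (by omega) (by omega), hpat j h1 h2⟩
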